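/- There exists a connected graph G of order 16 with maximum degree 3 such that Z(G) > 16/3 + 2 (in fact Z(G) = 8); hence the conjecture 'Z(G) ≤ n/3 + 2 for every connected graph of order n with maximum degree 3' is false. -/

import Mathlib

open Matrix Finset

variable {V : Type*}

/-- `A` is a real symmetric matrix whose off-diagonal nonzero pattern is given by `G`. -/
def IsGraphMatrix [Fintype V] (G : SimpleGraph V) (A : Matrix V V ℝ) : Prop :=
  A.IsSymm ∧ ∀ i j : V, i ≠ j → (A i j ≠ 0 ↔ G.Adj i j)

/-- The nullity of a square real matrix. -/
noncomputable def nullity [Fintype V] (A : Matrix V V ℝ) : ℕ :=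
  Fintype.card V - A.rank

/-- The minimum rank of a graph. -/
noncomputable def minRank [Fintype V] (G : SimpleGraph V) : ℕ :=
  sInf {r : ℕ | ∃ A : Matrix V V ℝ, IsGraphMatrix G A ∧ A.rank = r}

/-- The maximum nullity of a graph. -/
noncomputable def maxNullity [Fintype V] (G : SimpleGraph V) : ℕ :=
  sSup {k : ℕ | ∃ A : Matrix V V ℝ, IsGraphMatrix G A ∧ nullity A = k}

/-- The set of vertices eventually colored black by the color-change rule,
starting from the initially black set `Z`. A black vertex `u` with exactly one
white neighbor `v` forces `v` black. -/
inductive ZForced (G : SimpleGraph V) (Z : Set V) : V → Prop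
  | init : ∀ {v}, v ∈ Z → ZForced G Z v
  | force : ∀ {u v}, G.Adj u v → ZForced G Z u →
      (∀ w, G.Adj u w → w ≠ v → ZForced G Z w) → ZForced G Z v

/-- `Z` is a zero forcing set for `G`. -/
def IsZeroForcingSet (G : SimpleGraph V) (Z : Set V) : Prop :=
  ∀ v : V, ZForced G Z v

/-- The zero forcing number of `G`. -/
noncomputable def zeroForcingNumber [Fintype V] (G : SimpleGraph V) : ℕ :=
  sInf {k : ℕ | ∃ Z : Finset V, Z.card = k ∧ IsZeroForcingSet G ↑Z}

/-- The edges of the counterexample graph of Fig. 1 (0-indexed). -/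
def counterEdges : List (Fin 16 × Fin 16) :=
  [(0, 1), (0, 2), (0, 3), (1, 4), (1, 5), (2, 6), (2, 7), (3, 8), (3, 9),
   (4, 10), (4, 11), (10, 11), (5, 10), (5, 11), (6, 12), (6, 13), (12, 13),
   (7, 12), (7, 13), (8, 14), (8, 15), (14, 15), (9, 14), (9, 15)]

def counterRel (a b : Fin 16) : Prop := (a, b) ∈ counterEdges

/-- The counterexample graph of order 16. -/
def counterGraph : SimpleGraph (Fin 16) := SimpleGraph.fromRel counterRel

instance : DecidableRel counterRel := fun a b =>
  inferInstanceAs (Decidable ((a, b) ∈ counterEdges))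

instance : DecidableRel counterGraph.Adj := fun a b =>
  decidable_of_iff (a ≠ b ∧ (counterRel a b ∨ counterRel b a))
    (SimpleGraph.fromRel_adj counterRel a b).symm

/-- A zero forcing set meets every nonempty fort, that is, every nonempty set `F` such that no vertex
outside `F` has exactly one neighbor in `F`. -/
theorem IsZeroForcingSet.exists_mem_fort {G : SimpleGraph V} {Z : Set V} (hZ : IsZeroForcingSet G Z)
    {F : Finset V} (hF : F.Nonempty)
    (hfort : ∀ u ∉ F, ∀ v ∈ F, G.Adj u v → ∃ w ∈ F, w ≠ v ∧ G.Adj u w) : ∃ v ∈ F, v ∈ Z := by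
  by_contra! hdisj
  have hout : ∀ v, ZForced G Z v → v ∉ F := by
    intro v hv
    induction hv with
    | init hv => exact fun h => hdisj _ h hv
    | force hadj _ _ ihu ih =>
      intro hvF
      obtain ⟨w, hwF, hwv, huw⟩ := hfort _ ihu _ hvF hadj
      exact ih w huw hwv hwF
  obtain ⟨v, hv⟩ := hF
  exact hout v (hZ v) hv

/-- One application of the color-change rule to a set of black vertices. -/
theorem ZForced.forall_mem_insert [DecidableEq V] {G : SimpleGraph V} {Z : Set V} {S : Finset V}
    (hS : ∀ x ∈ S, ZForced G Z x) (u v : V) (hu : u ∈ S) (huv : G.Adj u v)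
    (h : ∀ w, G.Adj u w → w ≠ v → w ∈ S) : ∀ x ∈ insert v S, ZForced G Z x := by
  intro x hx
  rcases Finset.mem_insert.mp hx with rfl | hx
  · exact .force huv (hS u hu) fun w hw hwx => hS w (h w hw hwx)
  · exact hS x hx

/-- The neighbor of the root in the `i`-th branch of the counterexample graph. -/
def branchHub (i : Fin 3) : Fin 16 := ⟨1 + i, by omega⟩

/-- The two children of the hub in the `i`-th branch. -/
def branchMid (i : Fin 3) (b : Fin 2) : Fin 16 := ⟨4 + 2 * i + b, by omega⟩

/-- The two vertices farthest from the root in the `i`-th branch. -/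
def branchLeaf (i : Fin 3) (b : Fin 2) : Fin 16 := ⟨10 + 2 * i + b, by omega⟩

/-- The vertices of the `i`-th branch. -/
def branch (i : Fin 3) : Finset (Fin 16) :=
  {branchHub i, branchMid i 0, branchMid i 1, branchLeaf i 0, branchLeaf i 1}

/-- The hub of the `i`-th branch together with one vertex of each twin pair; two of these from
distinct branches form a fort. -/
def halfFort (i : Fin 3) (b c : Fin 2) : Finset (Fin 16) :=
  {branchHub i, branchMid i b, branchLeaf i c}

theorem counterGraph_connected : counterGraph.Connected := by
  have hparent : ∀ v : Fin 16, v ≠ 0 → ∃ u < v, counterGraph.Adj u v := by decide +kernel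
  have hroot : ∀ v : Fin 16, counterGraph.Reachable 0 v := by
    intro v
    induction v using WellFoundedLT.induction with
    | ind v ih =>
      by_cases hv : v = 0
      · subst hv; rfl
      · obtain ⟨u, hu, huv⟩ := hparent v hv
        exact (ih u hu).trans huv.reachable
  exact (SimpleGraph.connected_iff_exists_forall_reachable _).mpr ⟨0, hroot⟩

theorem counterGraph_isZeroForcingSet :
    IsZeroForcingSet counterGraph
      (({4, 6, 7, 8, 9, 10, 12, 14} : Finset (Fin 16)) : Set (Fin 16)) := by
  have h := fun x hx => ZForced.init (G := counterGraph)
    (Finset.mem_coe.mpr hx : x ∈ (({4, 6, 7, 8, 9, 10, 12, 14} : Finset (Fin 16)) : Set (Fin 16)))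
  replace h := ZForced.forall_mem_insert h 12 13 (by decide) (by decide) (by decide +kernel)
  replace h := ZForced.forall_mem_insert h 14 15 (by decide) (by decide) (by decide +kernel)
  replace h := ZForced.forall_mem_insert h 6 2 (by decide) (by decide) (by decide +kernel)
  replace h := ZForced.forall_mem_insert h 8 3 (by decide) (by decide) (by decide +kernel)
  replace h := ZForced.forall_mem_insert h 2 0 (by decide) (by decide) (by decide +kernel)
  replace h := ZForced.forall_mem_insert h 0 1 (by decide) (by decide) (by decide +kernel)
  replace h := ZForced.forall_mem_insert h 4 11 (by decide) (by decide) (by decide +kernel)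
  replace h := ZForced.forall_mem_insert h 10 5 (by decide) (by decide) (by decide +kernel)
  exact fun v => h v (by revert v; decide +kernel)

theorem halfFort_union_isFort : ∀ i j, i ≠ j → ∀ b c d e,
    ∀ u ∉ halfFort i b c ∪ halfFort j d e, ∀ v ∈ halfFort i b c ∪ halfFort j d e,
    counterGraph.Adj u v →
      ∃ w ∈ halfFort i b c ∪ halfFort j d e, w ≠ v ∧ counterGraph.Adj u w := by
  decide +kernel

theorem eight_le_card_of_isZeroForcingSet {Z : Finset (Fin 16)}
    (hZ : IsZeroForcingSet counterGraph (Z : Set (Fin 16))) : 8 ≤ Z.card := by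
  have hmid : ∀ i, ∃ b, branchMid i b ∈ Z := fun i => by
    simpa using hZ.exists_mem_fort (F := univ.image (branchMid i)) (by simp)
      (by revert i; decide +kernel)
  have hleaf : ∀ i, ∃ c, branchLeaf i c ∈ Z := fun i => by
    simpa using hZ.exists_mem_fort (F := univ.image (branchLeaf i)) (by simp)
      (by revert i; decide +kernel)
  have hpairb : ∀ i b c, {branchMid i b, branchLeaf i c} ⊆ branch i ∧
      ({branchMid i b, branchLeaf i c} : Finset (Fin 16)).card = 2 := by decide +kernel
  have htriple : ∀ i b c, ∀ v ∈ halfFort i (b + 1) (c + 1),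
      {v, branchMid i b, branchLeaf i c} ⊆ branch i ∧
      ({v, branchMid i b, branchLeaf i c} : Finset (Fin 16)).card = 3 := by decide +kernel
  have hcard : ∀ i, 2 ≤ (branch i ∩ Z).card ∧
      (3 ≤ (branch i ∩ Z).card ∨ ∃ b c, ∀ v ∈ halfFort i b c, v ∉ Z) := by
    intro i
    obtain ⟨b, hb⟩ := hmid i
    obtain ⟨c, hc⟩ := hleaf i
    have hbc : {branchMid i b, branchLeaf i c} ⊆ Z := by simp [insert_subset_iff, hb, hc]
    constructor
    · rw [← (hpairb i b c).2]
      exact card_le_card (subset_inter (hpairb i b c).1 hbc)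
    · by_cases! h : ∃ v ∈ halfFort i (b + 1) (c + 1), v ∈ Z
      · obtain ⟨v, hv, hvZ⟩ := h
        obtain ⟨hsub, h3⟩ := htriple i b c v hv
        rw [← h3]
        exact .inl (card_le_card (subset_inter hsub (insert_subset hvZ hbc)))
      · exact .inr ⟨b + 1, c + 1, h⟩
  have hpair : ∀ i j, i ≠ j → 3 ≤ (branch i ∩ Z).card ∨ 3 ≤ (branch j ∩ Z).card := by
    intro i j hij
    rcases (hcard i).2 with hi | ⟨b, c, hi⟩
    · exact .inl hi
    rcases (hcard j).2 with hj | ⟨d, e, hj⟩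
    · exact .inr hj
    obtain ⟨v, hv, hvZ⟩ := hZ.exists_mem_fort (F := halfFort i b c ∪ halfFort j d e)
      (by simp [halfFort]) (halfFort_union_isFort i j hij b c d e)
    rcases mem_union.mp hv with hv | hv
    · exact absurd hvZ (hi v hv)
    · exact absurd hvZ (hj v hv)
  have hdisj : ∀ i j, i ≠ j → Disjoint (branch i) (branch j) := by decide +kernel
  have hsum : ∑ i, (branch i ∩ Z).card ≤ Z.card := by
    rw [← card_biUnion fun i _ j _ hij =>
      (hdisj i j hij).mono inter_subset_left inter_subset_left]
    exact card_le_card (biUnion_subset.mpr fun i _ => inter_subset_right)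
  rw [Fin.sum_univ_three] at hsum
  have h0 := (hcard 0).1
  have h1 := (hcard 1).1
  have h2 := (hcard 2).1
  have h01 := hpair 0 1 (by decide)
  have h02 := hpair 0 2 (by decide)
  have h12 := hpair 1 2 (by decide)
  omega

theorem zeroForcingNumber_counterGraph : zeroForcingNumber counterGraph = 8 := by
  refine le_antisymm (Nat.sInf_le ⟨_, rfl, counterGraph_isZeroForcingSet⟩) ?_
  refine le_csInf ⟨_, _, rfl, counterGraph_isZeroForcingSet⟩ ?_
  rintro _ ⟨Z, rfl, hZ⟩
  exact eight_le_card_of_isZeroForcingSet hZ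

/-- There is a connected graph of order 16 with maximum degree 3 whose zero
forcing number exceeds `16/3 + 2` (in fact it equals 8), refuting the
conjecture `Z(G) ≤ n/3 + 2`. -/
theorem counterexample_to_conjecture :
    counterGraph.Connected ∧ counterGraph.maxDegree = 3 ∧
      ((16 : ℝ) / 3 + 2 < (zeroForcingNumber counterGraph : ℝ)) ∧
      zeroForcingNumber counterGraph = 8 := by
  refine ⟨counterGraph_connected, by decide +kernel, ?_, zeroForcingNumber_counterGraph⟩
  rw [zeroForcingNumber_counterGraph]
  norm_num
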